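/- Fix ε > 0 and F ∈ (1, ∞), and let p, q, r ∈ (2, ∞). Then there is no constant C > 0 such that for every Schwartz function g on ℝ³ the function u(t,x) = ∫_{ℝ³} exp(i x·ξ + i (t/ε) p_F(ξ)) ĝ(ξ) dξ satisfies ‖u‖_{L^p_t L^q_x} ≤ C ‖g‖_{L^r(ℝ³)}. -/

import Mathlib

open MeasureTheory Complex
open scoped ENNReal RealInnerProductSpace

noncomputable section

/-- Fourier transform `f̂(ξ) = ∫ e^{-i x·ξ} f(x) dx` on `ℝⁿ`. -/
def fourierTf {n : ℕ} (f : EuclideanSpace ℝ (Fin n) → ℂ) (ξ : EuclideanSpace ℝ (Fin n)) : ℂ :=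
  ∫ x : EuclideanSpace ℝ (Fin n), Complex.exp (-Complex.I * Complex.ofReal ⟪x, ξ⟫) * f x

/-- The dispersion relation `p_F(ξ) = |ξ|_F / (F |ξ|)`. -/
def pF (F : ℝ) (ξ : EuclideanSpace ℝ (Fin 3)) : ℝ :=
  Real.sqrt ((ξ 0) ^ 2 + (ξ 1) ^ 2 + (F * ξ 2) ^ 2) / (F * ‖ξ‖)

/-- Mixed space-time norm `‖u‖_{L^p_t L^q_x}` (as an extended nonneg real). -/
def mixedNorm (p q : ℝ) (u : ℝ → EuclideanSpace ℝ (Fin 3) → ℂ) : ℝ≥0∞ :=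
  (∫⁻ t : ℝ, (∫⁻ x : EuclideanSpace ℝ (Fin 3), (‖u t x‖₊ : ℝ≥0∞) ^ q) ^ (p / q)) ^ (1 / p)

/-- Lebesgue `L^r` norm on `ℝ³` (as an extended nonneg real). -/
def lebesgueNorm (r : ℝ) (g : EuclideanSpace ℝ (Fin 3) → ℂ) : ℝ≥0∞ :=
  (∫⁻ x : EuclideanSpace ℝ (Fin 3), (‖g x‖₊ : ℝ≥0∞) ^ r) ^ (1 / r)

lemma pF_smul (F : ℝ) {l : ℝ} (hl : 0 < l) (ξ : EuclideanSpace ℝ (Fin 3)) :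
    pF F (l • ξ) = pF F ξ := by
  unfold pF
  have h : ((l • ξ) 0) ^ 2 + ((l • ξ) 1) ^ 2 + (F * (l • ξ) 2) ^ 2
      = l ^ 2 * ((ξ 0) ^ 2 + (ξ 1) ^ 2 + (F * ξ 2) ^ 2) := by
    simp only [PiLp.smul_apply, smul_eq_mul]; ring
  rw [h, Real.sqrt_mul (by positivity), Real.sqrt_sq hl.le, norm_smul, Real.norm_of_nonneg hl.le,
    show F * (l * ‖ξ‖) = l * (F * ‖ξ‖) by ring, mul_div_mul_left _ _ hl.ne']

lemma pF_measurable (F : ℝ) : Measurable (pF F) := by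
  unfold pF
  fun_prop

lemma pF_contDiffAt (F : ℝ) (hF : 1 < F) (ξ : EuclideanSpace ℝ (Fin 3)) (h : ξ ≠ 0) :
    ContDiffAt ℝ (⊤ : ℕ∞) (pF F) ξ := by
  unfold pF
  have hn : 0 < ‖ξ‖ := norm_pos_iff.mpr h
  have hpos : 0 < (ξ 0) ^ 2 + (ξ 1) ^ 2 + (F * ξ 2) ^ 2 := by
    have h1 : 0 < ‖ξ‖ ^ 2 := by positivity
    rw [EuclideanSpace.norm_sq_eq, Fin.sum_univ_three] at h1
    simp only [Real.norm_eq_abs, sq_abs] at h1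
    have h2 : 0 ≤ (F ^ 2 - 1) * ξ 2 ^ 2 :=
      mul_nonneg (by nlinarith) (sq_nonneg _)
    nlinarith
  refine ContDiffAt.div ?_ ?_ (by positivity)
  · refine ContDiffAt.sqrt ?_ hpos.ne'
    fun_prop
  · exact contDiffAt_const.mul (contDiffAt_norm ℝ h)

lemma lint_smul (f : EuclideanSpace ℝ (Fin 3) → ℝ≥0∞) {l : ℝ} (hl : 0 < l) :
    ∫⁻ x, f (l • x) = ENNReal.ofReal ((l ^ 3)⁻¹) * ∫⁻ x, f x := by
  have h := lintegral_map_equiv (μ := (volume : Measure (EuclideanSpace ℝ (Fin 3)))) f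
    (MeasurableEquiv.smul₀ l hl.ne')
  have h2 := Measure.map_addHaar_smul (volume : Measure (EuclideanSpace ℝ (Fin 3))) hl.ne'
  rw [show (⇑(MeasurableEquiv.smul₀ l hl.ne') : EuclideanSpace ℝ (Fin 3) → _) = (l • ·) from rfl,
    h2, lintegral_smul_measure] at h
  rw [← h, finrank_euclideanSpace_fin, abs_of_pos (by positivity), smul_eq_mul]

lemma int_smul (f : EuclideanSpace ℝ (Fin 3) → ℂ) {l : ℝ} (hl : 0 < l) :
    ∫ x, f (l • x) = ((l ^ 3)⁻¹ : ℝ) • ∫ x, f x := by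
  rw [Measure.integral_comp_smul, finrank_euclideanSpace_fin, abs_of_pos (by positivity)]

/-- The solution operator. -/
def Usol (ε F : ℝ) (g : EuclideanSpace ℝ (Fin 3) → ℂ) (t : ℝ) (x : EuclideanSpace ℝ (Fin 3)) : ℂ :=
  ∫ ξ : EuclideanSpace ℝ (Fin 3),
    Complex.exp (Complex.I * Complex.ofReal (⟪x, ξ⟫ + (t / ε) * pF F ξ)) * fourierTf g ξ

lemma fourierTf_scale (g : EuclideanSpace ℝ (Fin 3) → ℂ) {l : ℝ} (hl : 0 < l)
    (ξ : EuclideanSpace ℝ (Fin 3)) :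
    fourierTf (fun y => g (l • y)) (l • ξ) = ((l ^ 3)⁻¹ : ℝ) • fourierTf g ξ := by
  unfold fourierTf
  rw [← int_smul _ hl]
  simp only [real_inner_smul_left, real_inner_smul_right]

lemma Usol_scale (ε F : ℝ) (g : EuclideanSpace ℝ (Fin 3) → ℂ) {l : ℝ} (hl : 0 < l) (t : ℝ)
    (x : EuclideanSpace ℝ (Fin 3)) :
    Usol ε F (fun y => g (l • y)) t x = Usol ε F g t (l • x) := by
  have h := int_smul (fun ξ => Complex.exp (Complex.I * Complex.ofReal
    (⟪x, ξ⟫ + (t / ε) * pF F ξ)) * fourierTf (fun y => g (l • y)) ξ) hl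
  have hne : ((l ^ 3)⁻¹ : ℝ) ≠ 0 := by positivity
  apply smul_right_injective ℂ hne
  simp only [Usol]
  rw [← h, ← integral_smul]
  congr 1; ext ξ
  rw [fourierTf_scale g hl, pF_smul F hl, real_inner_smul_left, real_inner_smul_right,
    mul_smul_comm]

lemma mixedNorm_scale (p q : ℝ) (hp : 2 < p) (hq : 2 < q)
    (u : ℝ → EuclideanSpace ℝ (Fin 3) → ℂ) {l : ℝ} (hl : 0 < l) :
    mixedNorm p q (fun t x => u t (l • x)) =
      ENNReal.ofReal ((l ^ 3)⁻¹) ^ (1 / q) * mixedNorm p q u := by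
  unfold mixedNorm
  have h : ∀ t, ∫⁻ x : EuclideanSpace ℝ (Fin 3), (‖u t (l • x)‖₊ : ℝ≥0∞) ^ q =
    ENNReal.ofReal ((l ^ 3)⁻¹) * ∫⁻ x, (‖u t x‖₊ : ℝ≥0∞) ^ q := fun t =>
    lint_smul (fun x => (‖u t x‖₊ : ℝ≥0∞) ^ q) hl
  simp only [h]
  have hpq : 0 ≤ p / q := by positivity
  simp only [ENNReal.mul_rpow_of_nonneg _ _ hpq]
  rw [lintegral_const_mul' _ _ (ENNReal.rpow_ne_top_of_nonneg hpq ENNReal.ofReal_ne_top),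
    ENNReal.mul_rpow_of_nonneg _ _ (by positivity), ← ENNReal.rpow_mul]
  congr 2
  field_simp

lemma lebesgueNorm_scale (r : ℝ) (hr : 2 < r)
    (g : EuclideanSpace ℝ (Fin 3) → ℂ) {l : ℝ} (hl : 0 < l) :
    lebesgueNorm r (fun x => g (l • x)) =
      ENNReal.ofReal ((l ^ 3)⁻¹) ^ (1 / r) * lebesgueNorm r g := by
  unfold lebesgueNorm
  rw [lint_smul (fun x => (‖g x‖₊ : ℝ≥0∞) ^ r) hl, ENNReal.mul_rpow_of_nonneg _ _ (by positivity)]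

lemma lebesgueNorm_ne_top (r : ℝ) (hr : 2 < r) (g : SchwartzMap (EuclideanSpace ℝ (Fin 3)) ℂ) :
    lebesgueNorm r (fun y => g y) ≠ ⊤ := by
  have h := (g.eLpNorm_lt_top (ENNReal.ofReal r) volume).ne
  rw [eLpNorm_eq_lintegral_rpow_enorm_toReal (by simp; linarith) ENNReal.ofReal_ne_top,
    ENNReal.toReal_ofReal (by linarith)] at h
  exact h

lemma mixedNorm_pos (p q : ℝ) (hp : 2 < p) (hq : 2 < q)
    (u : ℝ → EuclideanSpace ℝ (Fin 3) → ℂ) (hc : Continuous (Function.uncurry u))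
    (h0 : u 0 0 ≠ 0) : mixedNorm p q u ≠ 0 := by
  have hn : 0 < ‖u 0 0‖₊ := by simpa using h0
  obtain ⟨c, hc0, hcu⟩ := exists_between hn
  have hev : ∀ᶠ z in nhds ((0 : ℝ), (0 : EuclideanSpace ℝ (Fin 3))),
      c < ‖Function.uncurry u z‖₊ :=
    (hc.nnnorm.tendsto _).eventually (lt_mem_nhds hcu)
  rw [nhds_prod_eq] at hev
  obtain ⟨s, hs, t, ht, hst⟩ := Filter.mem_prod_iff.mp hev
  obtain ⟨s', hs's, hs'o, hs'm⟩ := mem_nhds_iff.mp hs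
  obtain ⟨t', ht's, ht'o, ht'm⟩ := mem_nhds_iff.mp ht
  have hs0 := (hs'o.measure_pos volume ⟨_, hs'm⟩).ne'
  have ht0 := (ht'o.measure_pos volume ⟨_, ht'm⟩).ne'
  have hq0 : 0 < q := by linarith
  have hp0 : 0 < p := by linarith
  have hin : ∀ τ ∈ s', (c : ℝ≥0∞) ^ q * volume t' ≤
      ∫⁻ x : EuclideanSpace ℝ (Fin 3), (‖u τ x‖₊ : ℝ≥0∞) ^ q := by
    intro τ hτ
    rw [← setLIntegral_const]
    refine le_trans (setLIntegral_mono' ht'o.measurableSet fun x hx => ?_)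
      (setLIntegral_le_lintegral t' _)
    have : c < ‖u τ x‖₊ := hst (Set.mk_mem_prod (hs's hτ) (ht's hx))
    gcongr
  have hout : ((c : ℝ≥0∞) ^ q * volume t') ^ (p / q) * volume s' ≤
      ∫⁻ τ : ℝ, (∫⁻ x : EuclideanSpace ℝ (Fin 3), (‖u τ x‖₊ : ℝ≥0∞) ^ q) ^ (p / q) := by
    rw [← setLIntegral_const]
    refine le_trans (setLIntegral_mono' hs'o.measurableSet fun τ hτ => ?_)
      (setLIntegral_le_lintegral s' _)
    exact ENNReal.rpow_le_rpow (hin τ hτ) (by positivity)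
  unfold mixedNorm
  intro hz
  rw [ENNReal.rpow_eq_zero_iff_of_pos (by positivity)] at hz
  rw [hz, nonpos_iff_eq_zero, mul_eq_zero, ENNReal.rpow_eq_zero_iff_of_pos (by positivity),
    mul_eq_zero, ENNReal.rpow_eq_zero_iff_of_pos hq0] at hout
  rcases hout with (h | h) | h
  · simp at h; exact hc0.ne' h
  · exact ht0 h
  · exact hs0 h

lemma mixedNorm_shift (p q s : ℝ) (u : ℝ → EuclideanSpace ℝ (Fin 3) → ℂ) :
    mixedNorm p q (fun t x => u (t + s) x) = mixedNorm p q u := by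
  unfold mixedNorm
  rw [lintegral_add_right_eq_self
    (fun t => (∫⁻ x : EuclideanSpace ℝ (Fin 3), (‖u t x‖₊ : ℝ≥0∞) ^ q) ^ (p / q))]

lemma Usol_continuous (ε F : ℝ) (g : EuclideanSpace ℝ (Fin 3) → ℂ)
    (hg : Integrable (fourierTf g)) : Continuous (Function.uncurry (Usol ε F g)) := by
  unfold Usol Function.uncurry
  refine continuous_of_dominated (bound := fun ξ => ‖fourierTf g ξ‖) ?_ ?_ hg.norm ?_
  · intro z
    refine AEStronglyMeasurable.mul ?_ hg.aestronglyMeasurable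
    have := pF_measurable F
    refine Measurable.aestronglyMeasurable ?_
    fun_prop
  · intro z
    refine Filter.Eventually.of_forall fun ξ => ?_
    rw [norm_mul, mul_comm Complex.I, Complex.norm_exp_ofReal_mul_I, one_mul]
  · refine Filter.Eventually.of_forall fun ξ => ?_
    fun_prop

lemma fourierTf_eq (g : EuclideanSpace ℝ (Fin 3) → ℂ) (ξ : EuclideanSpace ℝ (Fin 3)) :
    fourierTf g ξ = FourierTransform.fourier g ((2 * Real.pi)⁻¹ • ξ) := by
  rw [Real.fourier_eq']
  unfold fourierTf
  congr 1; ext x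
  rw [smul_eq_mul, real_inner_smul_right]
  congr 2
  push_cast
  have : (Real.pi : ℂ) ≠ 0 := by exact_mod_cast Real.pi_ne_zero
  field_simp

/-- Bump function supported away from the origin. -/
def bumpE : ContDiffBump (EuclideanSpace.single (0 : Fin 3) (1 : ℝ)) := ⟨1/4, 1/2, by norm_num, by norm_num⟩

/-- Modulated bump. -/
def psiFun (F T : ℝ) (ξ : EuclideanSpace ℝ (Fin 3)) : ℂ :=
  Complex.exp (Complex.I * Complex.ofReal (T * pF F ξ)) * (bumpE ξ : ℝ)

lemma psiFun_compact (F T : ℝ) : HasCompactSupport (psiFun F T) := by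
  have h : HasCompactSupport (fun ξ => ((bumpE ξ : ℝ) : ℂ)) :=
    bumpE.hasCompactSupport.comp_left (g := Complex.ofReal) (by simp)
  exact h.mul_left

lemma psiFun_contDiff (F T : ℝ) (hF : 1 < F) : ContDiff ℝ (⊤ : ℕ∞) (psiFun F T) := by
  rw [contDiff_iff_contDiffAt]
  intro ξ
  by_cases h : ξ = 0
  · subst h
    have hz : psiFun F T =ᶠ[nhds 0] fun _ => 0 := by
      filter_upwards [Metric.ball_mem_nhds (0 : EuclideanSpace ℝ (Fin 3))
        (show (0 : ℝ) < 1 / 2 by norm_num)] with y hy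
      have : bumpE y = 0 := by
        apply bumpE.zero_of_le_dist
        have h1 : dist (EuclideanSpace.single (0 : Fin 3) (1 : ℝ)) 0 = 1 := by simp
        have h2 := dist_triangle (EuclideanSpace.single (0 : Fin 3) (1 : ℝ)) y 0
        rw [Metric.mem_ball] at hy
        rw [dist_comm] at h2
        rw [dist_comm _ (0 : EuclideanSpace ℝ (Fin 3))] at h1
        rw [dist_comm _ y] at h2
        show (1 / 2 : ℝ) ≤ _
        linarith
      simp [psiFun, this]
    exact contDiffAt_const.congr_of_eventuallyEq hz
  · unfold psiFun
    have h1 := pF_contDiffAt F hF ξ h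
    have h2 : ContDiffAt ℝ (⊤ : ℕ∞) (fun ξ => ((T * pF F ξ : ℝ) : ℂ)) ξ :=
      Complex.ofRealCLM.contDiff.contDiffAt.comp ξ (contDiffAt_const.mul h1)
    have h3 : ContDiffAt ℝ (⊤ : ℕ∞) (fun ξ => ((bumpE ξ : ℝ) : ℂ)) ξ :=
      Complex.ofRealCLM.contDiff.contDiffAt.comp ξ bumpE.contDiffAt
    exact ((contDiffAt_const.mul h2).cexp).mul h3

/-- The Schwartz data. -/
def hT (F T : ℝ) (hF : 1 < F) : SchwartzMap (EuclideanSpace ℝ (Fin 3)) ℂ :=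
  FourierTransformInv.fourierInv
    ((psiFun_compact F T).toSchwartzMap (psiFun_contDiff F T hF))

lemma fourierTf_hT (F T : ℝ) (hF : 1 < F) (ξ : EuclideanSpace ℝ (Fin 3)) :
    fourierTf (fun y => hT F T hF y) ξ =
      Complex.exp (Complex.I * Complex.ofReal (T * pF F ξ)) *
        (bumpE ((2 * Real.pi)⁻¹ • ξ) : ℝ) := by
  rw [fourierTf_eq]
  change FourierTransform.fourier (⇑(hT F T hF)) _ = _
  rw [← SchwartzMap.fourier_coe, hT, FourierTransform.fourier_fourierInv_eq]
  change psiFun F T _ = _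
  unfold psiFun
  rw [pF_smul F (by positivity)]

lemma Usol_hT (ε F T : ℝ) (hε : 0 < ε) (hF : 1 < F) (t : ℝ) (x : EuclideanSpace ℝ (Fin 3)) :
    Usol ε F (fun y => hT F T hF y) t x = Usol ε F (fun y => hT F 0 hF y) (t + ε * T) x := by
  unfold Usol
  congr 1; ext ξ
  simp only [fourierTf_hT]
  rw [← mul_assoc, ← mul_assoc, ← Complex.exp_add, ← Complex.exp_add]
  congr 2
  push_cast
  have : (ε : ℂ) ≠ 0 := by exact_mod_cast hε.ne'
  field_simp
  ring

lemma hT_eq (ε F T : ℝ) (hε : 0 < ε) (hF : 1 < F) (x : EuclideanSpace ℝ (Fin 3)) :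
    hT F T hF x = (((2 * Real.pi) ^ 3)⁻¹ : ℝ) • Usol ε F (fun y => hT F 0 hF y) (ε * T) x := by
  have h1 := Usol_hT ε F T hε hF 0 x
  rw [zero_add] at h1
  rw [← h1]
  unfold Usol
  have h2 : hT F T hF x = FourierTransformInv.fourierInv (psiFun F T) x := by
    rw [hT, SchwartzMap.fourierInv_coe]
    rfl
  rw [← int_smul _ (by positivity : 0 < 2 * Real.pi), h2, Real.fourierInv_eq']
  congr 1; ext v
  have := fourierTf_hT F T hF ((2 * Real.pi) • v)
  rw [this, smul_smul, inv_mul_cancel₀ (by positivity), one_smul, pF_smul F (by positivity),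
    smul_eq_mul, psiFun, real_inner_smul_right, real_inner_comm]
  congr 2
  push_cast
  ring

lemma fourierTf_h0_integrable (F : ℝ) (hF : 1 < F) :
    Integrable (fourierTf (fun y => hT F 0 hF y)) := by
  have h : fourierTf (fun y => hT F 0 hF y) =
      fun ξ => ((bumpE ((2 * Real.pi)⁻¹ • ξ) : ℝ) : ℂ) := by
    ext ξ; rw [fourierTf_hT]; simp
  rw [h]
  exact ((bumpE.integrable (μ := volume)).comp_smul (by positivity)).ofReal

lemma Usol_h0_ne (ε F : ℝ) (hF : 1 < F) : Usol ε F (fun y => hT F 0 hF y) 0 0 ≠ 0 := by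
  have h : Usol ε F (fun y => hT F 0 hF y) 0 0 =
      ∫ ξ : EuclideanSpace ℝ (Fin 3), ((bumpE ((2 * Real.pi)⁻¹ • ξ) : ℝ) : ℂ) := by
    unfold Usol
    congr 1; ext ξ; rw [fourierTf_hT]; simp
  rw [h, int_smul (fun ξ => ((bumpE ξ : ℝ) : ℂ)) (by positivity), integral_complex_ofReal]
  have := (bumpE.integral_pos (μ := volume)).ne'
  refine smul_ne_zero (by positivity) ?_
  exact_mod_cast this

/-- Dilated Schwartz data. -/
def dil (g : SchwartzMap (EuclideanSpace ℝ (Fin 3)) ℂ) (l : ℝ) (hl : 0 < l) :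
    SchwartzMap (EuclideanSpace ℝ (Fin 3)) ℂ :=
  SchwartzMap.compCLMOfContinuousLinearEquiv ℂ
    (ContinuousLinearEquiv.smulLeft (R₁ := ℝ) (Units.mk0 l hl.ne')) g

lemma scale_contra (q r : ℝ) (hq : 2 < q) (hr : 2 < r) (hqr : q ≠ r) (K M : ℝ≥0∞)
    (hK : K ≠ 0) (hM : M ≠ ⊤)
    (h : ∀ l : ℝ, 0 < l → ENNReal.ofReal ((l ^ 3)⁻¹) ^ (1 / q) * K ≤
      ENNReal.ofReal ((l ^ 3)⁻¹) ^ (1 / r) * M) : False := by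
  have hKt : K ≠ ⊤ := by
    rintro rfl
    have := h 1 one_pos
    simp at this
    exact hM this
  have hK' : 0 < K.toReal := ENNReal.toReal_pos hK hKt
  set d : ℝ := 1 / q - 1 / r with hd
  have hd0 : d ≠ 0 := by
    intro h0
    apply hqr
    have : 1 / q = 1 / r := by linarith
    simpa using this
  set B : ℝ := M.toReal / K.toReal + 1 with hB
  have hB0 : 0 < B := by positivity
  set a : ℝ := B ^ (1 / d) with ha
  have ha0 : 0 < a := by positivity
  have hl : ((a ^ (-(1:ℝ) / 3)) ^ 3)⁻¹ = a := by
    rw [← Real.rpow_natCast, ← Real.rpow_mul ha0.le, ← Real.rpow_neg ha0.le]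
    norm_num
  have h1 := h (a ^ (-(1:ℝ) / 3)) (by positivity)
  rw [hl, ENNReal.ofReal_rpow_of_pos ha0, ENNReal.ofReal_rpow_of_pos ha0] at h1
  have h2 := ENNReal.toReal_mono (ENNReal.mul_ne_top ENNReal.ofReal_ne_top hM) h1
  rw [ENNReal.toReal_mul, ENNReal.toReal_mul, ENNReal.toReal_ofReal (by positivity),
    ENNReal.toReal_ofReal (by positivity)] at h2
  have h3 : a ^ (1 / q) = a ^ (1 / r) * B := by
    rw [show 1 / q = 1 / r + d by rw [hd]; ring, Real.rpow_add ha0]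
    congr 1
    rw [ha, ← Real.rpow_mul hB0.le, one_div_mul_cancel hd0, Real.rpow_one]
  rw [h3, mul_assoc] at h2
  have h4 := le_of_mul_le_mul_left h2 (by positivity)
  rw [hB, add_mul, div_mul_cancel₀ _ hK'.ne'] at h4
  linarith

theorem no_lebesgue_data_estimate (ε F : ℝ) (hε : 0 < ε) (hF : 1 < F)
    (p q r : ℝ) (hp : 2 < p) (hq : 2 < q) (hr : 2 < r) :
    ¬ ∃ C : ℝ, 0 < C ∧ ∀ g : SchwartzMap (EuclideanSpace ℝ (Fin 3)) ℂ,
      mixedNorm p q (fun t x =>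
          ∫ ξ : EuclideanSpace ℝ (Fin 3),
            Complex.exp (Complex.I * Complex.ofReal (⟪x, ξ⟫ + (t / ε) * pF F ξ)) *
              fourierTf (fun y => g y) ξ)
        ≤ ENNReal.ofReal C * lebesgueNorm r (fun y => g y) := by
  rintro ⟨C, hC, H⟩
  replace H : ∀ g : SchwartzMap (EuclideanSpace ℝ (Fin 3)) ℂ,
      mixedNorm p q (Usol ε F (fun y => g y)) ≤
        ENNReal.ofReal C * lebesgueNorm r (fun y => g y) := H
  have hK0 : mixedNorm p q (Usol ε F (fun y => hT F 0 hF y)) ≠ 0 :=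
    mixedNorm_pos p q hp hq _ (Usol_continuous ε F _ (fourierTf_h0_integrable F hF))
      (Usol_h0_ne ε F hF)
  have hM : ENNReal.ofReal C * lebesgueNorm r (fun y => hT F 0 hF y) ≠ ⊤ :=
    ENNReal.mul_ne_top ENNReal.ofReal_ne_top (lebesgueNorm_ne_top r hr _)
  have hKt : mixedNorm p q (Usol ε F (fun y => hT F 0 hF y)) ≠ ⊤ :=
    ne_top_of_le_ne_top hM (H _)
  by_cases hqr : q = r
  · subst hqr
    have hp0 : 0 < p := by linarith
    have hq0 : 0 < q := by linarith
    set u := Usol ε F (fun y => hT F 0 hF y) with hu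
    set K := mixedNorm p q u with hK
    set c : ℝ≥0∞ := ENNReal.ofReal (((2 * Real.pi) ^ 3)⁻¹) with hc
    have key : ∀ s : ℝ, K ≤ ENNReal.ofReal C * (c *
        (∫⁻ x : EuclideanSpace ℝ (Fin 3), (‖u s x‖₊ : ℝ≥0∞) ^ q) ^ (1 / q)) := by
      intro s
      have h1 := H (hT F (s / ε) hF)
      have h2 : Usol ε F (fun y => hT F (s / ε) hF y) = fun t x => u (t + s) x := by
        ext t x
        rw [Usol_hT ε F (s / ε) hε hF, mul_div_cancel₀ _ hε.ne']
      rw [h2, mixedNorm_shift] at h1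
      refine h1.trans_eq ?_
      congr 1
      unfold lebesgueNorm
      have h3 : ∀ x, (‖hT F (s / ε) hF x‖₊ : ℝ≥0∞) ^ q = c ^ q * (‖u s x‖₊ : ℝ≥0∞) ^ q := by
        intro x
        rw [hT_eq ε F (s / ε) hε hF x, mul_div_cancel₀ _ hε.ne',
          ← ENNReal.mul_rpow_of_nonneg _ _ hq0.le]
        congr 1
        rw [nnnorm_smul, ENNReal.coe_mul]
        congr 1
        rw [hc, ← Real.enorm_of_nonneg (by positivity)]
        rfl
      simp only [h3]
      rw [lintegral_const_mul' _ _ (ENNReal.rpow_ne_top_of_nonneg hq0.le ENNReal.ofReal_ne_top),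
        ENNReal.mul_rpow_of_nonneg _ _ (by positivity), ← ENNReal.rpow_mul,
        mul_one_div_cancel hq0.ne', ENNReal.rpow_one]
    have hD0 : ENNReal.ofReal C * c ≠ 0 := by
      refine mul_ne_zero ?_ ?_
      · simpa using hC
      · rw [hc]; simp only [ne_eq, ENNReal.ofReal_eq_zero, not_le]; positivity
    have hDt : ENNReal.ofReal C * c ≠ ⊤ :=
      ENNReal.mul_ne_top ENNReal.ofReal_ne_top ENNReal.ofReal_ne_top
    have key2 : ∀ s : ℝ, (K / (ENNReal.ofReal C * c)) ^ p ≤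
        (∫⁻ x : EuclideanSpace ℝ (Fin 3), (‖u s x‖₊ : ℝ≥0∞) ^ q) ^ (p / q) := by
      intro s
      have h1 := key s
      rw [← mul_assoc] at h1
      have h2 := ENNReal.rpow_le_rpow (ENNReal.div_le_of_le_mul' h1) hp0.le
      rwa [← ENNReal.rpow_mul, one_div_mul_eq_div] at h2
    have h5 := lintegral_mono (μ := (volume : Measure ℝ)) key2
    rw [lintegral_const, Real.volume_univ, ENNReal.mul_top] at h5
    · apply hKt
      rw [hK, mixedNorm, top_le_iff.mp h5]
      exact ENNReal.top_rpow_of_pos (by positivity)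
    · rw [ne_eq, ENNReal.rpow_eq_zero_iff_of_pos hp0]
      exact (ENNReal.div_pos hK0 hDt).ne'
  · refine scale_contra q r hq hr hqr _ _ hK0 hM fun l hl => ?_
    have h1 := H (dil (hT F 0 hF) l hl)
    have h2 : (fun y => dil (hT F 0 hF) l hl y) = fun y => hT F 0 hF (l • y) := rfl
    have h3 : Usol ε F (fun y => hT F 0 hF (l • y)) =
        fun t x => Usol ε F (fun y => hT F 0 hF y) t (l • x) := by
      ext t x
      exact Usol_scale ε F (fun y => hT F 0 hF y) hl t x
    rw [h2, h3, mixedNorm_scale p q hp hq _ hl,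
      lebesgueNorm_scale r hr (fun y => hT F 0 hF y) hl] at h1
    rwa [mul_left_comm] at h1

end
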